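/- arXiv:1304.7037 — 2 statements merged into one kernel-verified Lean document; each statement's English description precedes it below -/
import Mathlib

section
/- Let w₀, w₁ ∈ ℂ be such that the segment w(t) = (1−t)·w₀ + t·w₁ satisfies w(t) ≠ 0 for all t ∈ [0,1]. Then ∫₀¹ | Im( (w₁ − w₀) / w(t) ) | dt ≤ π. -/
open MeasureTheory Complex intervalIntegral

/-- Along an affine path, the angular speed has constant numerator. -/
lemma im_sub_div_segment (w₀ w₁ : ℂ) (t : ℝ) :
    ((w₁ - w₀) / (((1 - t : ℝ) : ℂ) * w₀ + (t : ℂ) * w₁)).im =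
      (w₀.re * w₁.im - w₀.im * w₁.re) /
        normSq (((1 - t : ℝ) : ℂ) * w₀ + (t : ℂ) * w₁) := by
  simp only [div_im, add_re, add_im, re_ofReal_mul, im_ofReal_mul, sub_re, sub_im]
  rw [← sub_div]
  congr 1
  ring

/-- if the segment `w(t) = (1−t)·w₀ + t·w₁` avoids the origin for `t ∈ [0,1]`,
then the total variation of its angle, `∫₀¹ |Im((w₁ − w₀)/w(t))| dt`, is at most `π`. -/
theorem total_angle_variation_of_segment (w₀ w₁ : ℂ)
    (h : ∀ t : ℝ, t ∈ Set.Icc (0 : ℝ) 1 → ((1 - t : ℝ) : ℂ) * w₀ + (t : ℂ) * w₁ ≠ 0) :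
    ∫ t in (0 : ℝ)..1, |((w₁ - w₀) / (((1 - t : ℝ) : ℂ) * w₀ + (t : ℂ) * w₁)).im|
      ≤ Real.pi := by
  by_cases hc : w₀.re * w₁.im - w₀.im * w₁.re = 0
  · simp only [im_sub_div_segment, hc, zero_div, abs_zero, intervalIntegral.integral_zero]
    exact Real.pi_pos.le
  set c := |w₀.re * w₁.im - w₀.im * w₁.re| with hc_def
  have c_pos : 0 < c := abs_pos.mpr hc
  have c_sq : c ^ 2 = (w₀.re * w₁.im - w₀.im * w₁.re) ^ 2 := sq_abs _
  let p : ℝ → ℝ := fun t ↦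
    t * normSq (w₁ - w₀) + (w₀.re * (w₁.re - w₀.re) + w₀.im * (w₁.im - w₀.im))
  have key (t : ℝ) : c ^ 2 + p t ^ 2 =
      normSq (w₁ - w₀) * normSq (((1 - t : ℝ) : ℂ) * w₀ + (t : ℂ) * w₁) := by
    simp only [p, c_sq, normSq_apply, add_re, add_im, re_ofReal_mul, im_ofReal_mul, sub_re, sub_im]
    ring
  have hderiv : ∀ t ∈ Set.uIcc (0 : ℝ) 1, HasDerivAt (fun t ↦ Real.arctan (p t / c))
      |((w₁ - w₀) / (((1 - t : ℝ) : ℂ) * w₀ + (t : ℂ) * w₁)).im| t := by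
    intro t ht
    rw [Set.uIcc_of_le zero_le_one] at ht
    have hw : 0 < normSq (((1 - t : ℝ) : ℂ) * w₀ + (t : ℂ) * w₁) := normSq_pos.mpr (h t ht)
    have hp : HasDerivAt p (normSq (w₁ - w₀)) t := by
      have hq := ((hasDerivAt_id t).mul_const (normSq (w₁ - w₀))).add_const
        (w₀.re * (w₁.re - w₀.re) + w₀.im * (w₁.im - w₀.im))
      rw [one_mul] at hq
      exact hq
    convert (hp.div_const c).arctan using 1
    rw [im_sub_div_segment, abs_div, abs_of_pos hw, ← hc_def]
    have hd : normSq (w₁ - w₀) ≠ 0 := by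
      intro hd
      have hk := key t
      rw [hd, zero_mul] at hk
      nlinarith [sq_nonneg (p t)]
    have hs : 1 + (p t / c) ^ 2 =
        normSq (w₁ - w₀) * normSq (((1 - t : ℝ) : ℂ) * w₀ + (t : ℂ) * w₁) / c ^ 2 := by
      rw [← key t]
      field_simp
    rw [hs]
    field_simp
  rw [integral_eq_sub_of_hasDerivAt hderiv]
  · linarith [Real.arctan_lt_pi_div_two (p 1 / c), Real.neg_pi_div_two_lt_arctan (p 0 / c)]
  · exact intervalIntegrable_deriv_of_nonneg
      (fun t ht ↦ (hderiv t ht).continuousAt.continuousWithinAt)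
      (fun t ht ↦ hderiv t (Set.Ioo_subset_Icc_self ht)) (fun _ _ ↦ abs_nonneg _)
end

section
/- Let G be a group acting on a measurable space X, let ν be a finite measure on X invariant under the action of G, let H be a group, and let r : H → ℝ satisfy |r(uv) − r(u) − r(v)| ≤ D for all u, v ∈ H (where D ≥ 0). Let c : G × X → H satisfy the cocycle identity c(gh, x) = c(g, h·x)·c(h, x) for all g, h ∈ G and ν-almost every x ∈ X, and suppose that for every g ∈ G the function x ↦ r(c(g, x)) is ν-integrable. Then the function Φ : G → ℝ defined by Φ(g) := ∫_X r(c(g, x)) dν(x) satisfies |Φ(gh) − Φ(g) − Φ(h)| ≤ D·ν(X) for all g, h ∈ G; that is, Φ is a quasimorphism with defect at most D·ν(X). -/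
open MeasureTheory

/-- the Gambaudo–Ghys averaging construction. Given a group `G` acting by
measure-preserving maps on a finite measure space `(X, ν)`, a quasimorphism `r : H → ℝ` with
defect at most `D`, and a cocycle `c : G × X → H` (satisfying `c(gh, x) = c(g, h·x)·c(h, x)`
for a.e. `x`) such that `x ↦ r(c(g, x))` is integrable for every `g`, the averaged function
`Φ(g) = ∫_X r(c(g, x)) dν(x)` is a quasimorphism with defect at most `D·ν(X)`. -/
theorem averaged_cocycle_quasimorphism
    {G : Type*} [Group G] {X : Type*} [MeasurableSpace X] [MulAction G X]
    (ν : Measure X) [IsFiniteMeasure ν]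
    (hinv : ∀ g : G, MeasurePreserving (fun x : X => g • x) ν ν)
    {H : Type*} [Group H] (r : H → ℝ) (D : ℝ) (hD : 0 ≤ D)
    (hdef : ∀ u v : H, |r (u * v) - r u - r v| ≤ D)
    (c : G × X → H)
    (hcoc : ∀ g h : G, ∀ᵐ x ∂ν, c (g * h, x) = c (g, h • x) * c (h, x))
    (hint : ∀ g : G, Integrable (fun x => r (c (g, x))) ν) :
    ∀ g h : G,
      |(∫ x, r (c (g * h, x)) ∂ν) - (∫ x, r (c (g, x)) ∂ν) - (∫ x, r (c (h, x)) ∂ν)|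
        ≤ D * (ν Set.univ).toReal := by
  intro g h
  have hint_smul : Integrable (fun x => r (c (g, h • x))) ν :=
    (hinv h).integrable_comp_of_integrable (hint g)
  have integral_smul : ∫ x, r (c (g, x)) ∂ν = ∫ x, r (c (g, h • x)) ∂ν := by
    have hmeas : AEStronglyMeasurable (fun x => r (c (g, x)))
        (ν.map (fun x : X => h • x)) := by
      rw [(hinv h).map_eq]
      exact (hint g).aestronglyMeasurable
    rw [← integral_map (hinv h).aemeasurable hmeas, (hinv h).map_eq]
  have hint_sub : Integrable (fun x => r (c (g * h, x)) - r (c (g, h • x))) ν :=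
    (hint (g * h)).sub hint_smul
  rw [integral_smul, ← integral_sub (hint (g * h)) hint_smul,
    ← integral_sub hint_sub (hint h), ← Real.norm_eq_abs]
  refine norm_integral_le_of_norm_le_const ?_
  filter_upwards [hcoc g h] with x hx
  rw [hx]
  exact hdef _ _
end
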